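/- For every s ≥ 0, every ε ∈ (0, 1/6] and every γ ∈ (0,1) there exists C > 0 with the following property: for all real numbers ξ₀,…,ξ₄ and integers q₀,…,q₄ satisfying the convolution constraint, the ordering |(ξ₁,q₁)| ≥ |(ξ₂,q₂)| ≥ |(ξ₃,q₃)| ≥ |(ξ₄,q₄)|, as well as |(ξ₁,q₁)| ≥ 1, |(ξ₄,q₄)| ≥ γ|(ξ₁,q₁)| and ||(ξ₁,q₁)|² − |(ξ₀,q₀)|²| ≥ γ|(ξ₁,q₁)|², one has |ξ₀| ⟨(ξ₀,q₀)⟩^s ≤ C · ||(ξ₁,q₁)|² − |(ξ₀,q₀)|²|^(1/2) ⟨(ξ₁,q₁)⟩^(s−ε) ⟨(ξ₀,q₀)⟩^(−1/2−ε) ⟨(ξ₂,q₂)⟩^(1/6+ε) ⟨(ξ₃,q₃)⟩^(1/6+ε) ⟨(ξ₄,q₄)⟩^(1/6+ε). -/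

import Mathlib

/-- The weighted norm `|(ξ,q)| = (3ξ² + q²)^(1/2)` for `(ξ,q) ∈ ℝ × ℤ`. -/
noncomputable def wnorm (ξ : ℝ) (q : ℤ) : ℝ := Real.sqrt (3 * ξ ^ 2 + (q : ℝ) ^ 2)

/-- The Japanese bracket `⟨(ξ,q)⟩ = (1 + ξ² + q²)^(1/2)` for `(ξ,q) ∈ ℝ × ℤ`. -/
noncomputable def jb (ξ : ℝ) (q : ℤ) : ℝ := Real.sqrt (1 + ξ ^ 2 + (q : ℝ) ^ 2)

lemma wnorm_nonneg (ξ : ℝ) (q : ℤ) : 0 ≤ wnorm ξ q := Real.sqrt_nonneg _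

lemma wnorm_sq (ξ : ℝ) (q : ℤ) : wnorm ξ q ^ 2 = 3 * ξ ^ 2 + (q : ℝ) ^ 2 :=
  Real.sq_sqrt (by positivity)

lemma jb_sq (ξ : ℝ) (q : ℤ) : jb ξ q ^ 2 = 1 + ξ ^ 2 + (q : ℝ) ^ 2 :=
  Real.sq_sqrt (by positivity)

lemma one_le_jb (ξ : ℝ) (q : ℤ) : 1 ≤ jb ξ q :=
  Real.one_le_sqrt.2 (by nlinarith [sq_nonneg ξ, sq_nonneg (q : ℝ)])

lemma jb_nonneg (ξ : ℝ) (q : ℤ) : 0 ≤ jb ξ q := Real.sqrt_nonneg _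

lemma abs_le_jb (ξ : ℝ) (q : ℤ) : |ξ| ≤ jb ξ q :=
  Real.abs_le_sqrt (by nlinarith [sq_nonneg (q : ℝ)])

lemma jb_sq_le_two_mul_wnorm_sq {ξ : ℝ} {q : ℤ} (h : 1 ≤ wnorm ξ q) :
    jb ξ q ^ 2 ≤ 2 * wnorm ξ q ^ 2 := by
  have h1 : 1 ≤ wnorm ξ q ^ 2 := one_le_pow₀ h
  rw [jb_sq]
  rw [wnorm_sq] at h1 ⊢
  nlinarith [sq_nonneg ξ]

/-- Brackets are comparable from below when the weighted norms are. -/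
lemma mul_jb_le_jb {γ ξ η : ℝ} {q r : ℤ} (hγ : 0 ≤ γ) (h : 1 ≤ wnorm ξ q)
    (h' : γ * wnorm ξ q ≤ wnorm η r) : γ / 3 * jb ξ q ≤ jb η r := by
  refine le_of_sq_le_sq ?_ (jb_nonneg _ _)
  have h1 := jb_sq_le_two_mul_wnorm_sq h
  have h2 : (γ * wnorm ξ q) ^ 2 ≤ wnorm η r ^ 2 :=
    pow_le_pow_left₀ (mul_nonneg hγ (wnorm_nonneg _ _)) h' 2
  have h3 : wnorm η r ^ 2 ≤ 3 * jb η r ^ 2 := by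
    rw [wnorm_sq, jb_sq]; nlinarith [sq_nonneg (r : ℝ)]
  have h4 := mul_le_mul_of_nonneg_left h1 (sq_nonneg γ)
  nlinarith [sq_nonneg (γ * jb ξ q), sq_nonneg (jb η r)]

lemma sq_sum_four_le (a b c d : ℝ) :
    (a + b + c + d) ^ 2 ≤ 4 * (a ^ 2 + b ^ 2 + c ^ 2 + d ^ 2) := by
  nlinarith [sq_nonneg (a - b), sq_nonneg (a - c), sq_nonneg (a - d), sq_nonneg (b - c),
    sq_nonneg (b - d), sq_nonneg (c - d)]

/-- The bracket of a sum of four frequencies is controlled by that of the largest one. -/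
lemma jb_sum_four_le {ξ₁ ξ₂ ξ₃ ξ₄ : ℝ} {q₁ q₂ q₃ q₄ : ℤ} (h₂ : wnorm ξ₂ q₂ ≤ wnorm ξ₁ q₁)
    (h₃ : wnorm ξ₃ q₃ ≤ wnorm ξ₁ q₁) (h₄ : wnorm ξ₄ q₄ ≤ wnorm ξ₁ q₁) :
    jb (ξ₁ + ξ₂ + ξ₃ + ξ₄) (q₁ + q₂ + q₃ + q₄) ≤ 7 * jb ξ₁ q₁ := by
  refine le_of_sq_le_sq ?_ (mul_nonneg (by norm_num) (jb_nonneg _ _))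
  have e₂ := pow_le_pow_left₀ (wnorm_nonneg _ _) h₂ 2
  have e₃ := pow_le_pow_left₀ (wnorm_nonneg _ _) h₃ 2
  have e₄ := pow_le_pow_left₀ (wnorm_nonneg _ _) h₄ 2
  simp only [wnorm_sq] at e₂ e₃ e₄
  rw [mul_pow, jb_sq, jb_sq]
  push_cast
  have := sq_sum_four_le ξ₁ ξ₂ ξ₃ ξ₄
  have := sq_sum_four_le (q₁ : ℝ) q₂ q₃ q₄
  linarith [sq_nonneg ξ₁, sq_nonneg ξ₂, sq_nonneg ξ₃, sq_nonneg ξ₄, sq_nonneg (q₁ : ℝ),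
    sq_nonneg (q₂ : ℝ), sq_nonneg (q₃ : ℝ), sq_nonneg (q₄ : ℝ)]

lemma mul_jb_le_rpow_half {γ ξ D : ℝ} {q : ℤ} (hγ : γ ∈ Set.Ioo (0 : ℝ) 1)
    (h : 1 ≤ wnorm ξ q) (hD : γ * wnorm ξ q ^ 2 ≤ D) :
    γ / 2 * jb ξ q ≤ D ^ ((1 : ℝ) / 2) := by
  rw [← Real.sqrt_eq_rpow]
  refine Real.le_sqrt_of_sq_le ?_
  have h1 := mul_le_mul_of_nonneg_left (jb_sq_le_two_mul_wnorm_sq h) hγ.1.le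
  have h2 : γ ^ 2 * jb ξ q ^ 2 ≤ γ * jb ξ q ^ 2 :=
    mul_le_mul_of_nonneg_right (by nlinarith [hγ.1, hγ.2]) (sq_nonneg _)
  nlinarith [mul_nonneg hγ.1.le (sq_nonneg (jb ξ q))]

/-- Exponent bookkeeping: if `A ≲ B` and `1 ≤ B`, then `A ^ (s + 1)` is controlled by the product
of powers of `A` and `B` of total degree `s + 1 + ε`. -/
lemma rpow_add_one_le_mul {s ε A B : ℝ} (hs : 0 ≤ s) (hε : 0 ≤ ε) (hA : 0 < A) (hB : 1 ≤ B)
    (hAB : A ≤ 7 * B) :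
    A * A ^ s ≤ 7 ^ (s + 3 / 2 + ε) * (B * B ^ (s - ε) * A ^ (-(1 : ℝ) / 2 - ε) *
      B ^ ((1 : ℝ) / 6 + ε) * B ^ ((1 : ℝ) / 6 + ε) * B ^ ((1 : ℝ) / 6 + ε)) := by
  have hB0 : 0 < B := by linarith
  calc A * A ^ s = A ^ (s + 3 / 2 + ε) * A ^ (-(1 : ℝ) / 2 - ε) := by
        rw [← Real.rpow_add hA, mul_comm, ← Real.rpow_add_one hA.ne']
        ring_nf
    _ ≤ (7 * B) ^ (s + 3 / 2 + ε) * A ^ (-(1 : ℝ) / 2 - ε) := by gcongr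
    _ = 7 ^ (s + 3 / 2 + ε) * (B ^ (s + 3 / 2 + ε) * A ^ (-(1 : ℝ) / 2 - ε)) := by
        rw [Real.mul_rpow (by norm_num) hB0.le, mul_assoc]
    _ ≤ 7 ^ (s + 3 / 2 + ε) * (B ^ (s + 3 / 2 + 2 * ε) * A ^ (-(1 : ℝ) / 2 - ε)) := by
        gcongr
        linarith
    _ = _ := by
        have : B ^ (s + 3 / 2 + 2 * ε) = B * B ^ (s - ε) * B ^ ((1 : ℝ) / 6 + ε) *
            B ^ ((1 : ℝ) / 6 + ε) * B ^ ((1 : ℝ) / 6 + ε) := by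
          rw [mul_comm B, ← Real.rpow_add_one hB0.ne', ← Real.rpow_add hB0, ← Real.rpow_add hB0,
            ← Real.rpow_add hB0]
          ring_nf
        rw [this]
        ring

theorem stmt_3 (s : ℝ) (hs : 0 ≤ s) (ε : ℝ) (hε : 0 < ε ∧ ε ≤ 1 / 6)
    (γ : ℝ) (hγ : γ ∈ Set.Ioo (0 : ℝ) 1) :
    ∃ C : ℝ, 0 < C ∧
      ∀ (ξ₀ ξ₁ ξ₂ ξ₃ ξ₄ : ℝ) (q₀ q₁ q₂ q₃ q₄ : ℤ),
        ξ₀ = ξ₁ + ξ₂ + ξ₃ + ξ₄ → q₀ = q₁ + q₂ + q₃ + q₄ →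
        wnorm ξ₂ q₂ ≤ wnorm ξ₁ q₁ → wnorm ξ₃ q₃ ≤ wnorm ξ₂ q₂ →
        wnorm ξ₄ q₄ ≤ wnorm ξ₃ q₃ →
        1 ≤ wnorm ξ₁ q₁ →
        γ * wnorm ξ₁ q₁ ≤ wnorm ξ₄ q₄ →
        γ * wnorm ξ₁ q₁ ^ 2 ≤ |wnorm ξ₁ q₁ ^ 2 - wnorm ξ₀ q₀ ^ 2| →
        |ξ₀| * jb ξ₀ q₀ ^ s ≤
          C * (|wnorm ξ₁ q₁ ^ 2 - wnorm ξ₀ q₀ ^ 2| ^ ((1 : ℝ) / 2) *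
            jb ξ₁ q₁ ^ (s - ε) * jb ξ₀ q₀ ^ (-(1 : ℝ) / 2 - ε) *
            jb ξ₂ q₂ ^ ((1 : ℝ) / 6 + ε) *
            jb ξ₃ q₃ ^ ((1 : ℝ) / 6 + ε) *
            jb ξ₄ q₄ ^ ((1 : ℝ) / 6 + ε)) := by
  obtain ⟨hγ0, hγ1⟩ := hγ
  set a : ℝ := 1 / 6 + ε with ha
  have ha0 : 0 ≤ a := by linarith [hε.1]
  have hc : 0 < γ / 2 * ((γ / 3) ^ a) ^ 3 := by positivity
  refine ⟨7 ^ (s + 3 / 2 + ε) / (γ / 2 * ((γ / 3) ^ a) ^ 3), by positivity, ?_⟩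
  intro ξ₀ ξ₁ ξ₂ ξ₃ ξ₄ q₀ q₁ q₂ q₃ q₄ hξ hq h₂ h₃ h₄ h₁ hγ₄ hD
  have hA := one_le_jb ξ₀ q₀
  have hB := one_le_jb ξ₁ q₁
  have hAB : jb ξ₀ q₀ ≤ 7 * jb ξ₁ q₁ := by
    rw [hξ, hq]
    exact jb_sum_four_le h₂ (h₃.trans h₂) (h₄.trans (h₃.trans h₂))
  have comparable {ξ : ℝ} {q : ℤ} (h : γ * wnorm ξ₁ q₁ ≤ wnorm ξ q) :
      (γ / 3) ^ a * jb ξ₁ q₁ ^ a ≤ jb ξ q ^ a := by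
    rw [← Real.mul_rpow (by positivity) (jb_nonneg _ _)]
    exact Real.rpow_le_rpow (mul_nonneg (by positivity) (jb_nonneg _ _))
      (mul_jb_le_jb hγ0.le h₁ h) ha0
  have c₄ := comparable hγ₄
  have c₃ := comparable (hγ₄.trans h₄)
  have c₂ := comparable (hγ₄.trans (h₄.trans h₃))
  have hd := mul_jb_le_rpow_half ⟨hγ0, hγ1⟩ h₁ hD
  have key := rpow_add_one_le_mul hs hε.1.le (by linarith) hB hAB
  have hA0 := jb_nonneg ξ₀ q₀
  have hB0 := jb_nonneg ξ₁ q₁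
  have := jb_nonneg ξ₂ q₂
  have := jb_nonneg ξ₃ q₃
  calc |ξ₀| * jb ξ₀ q₀ ^ s ≤ jb ξ₀ q₀ * jb ξ₀ q₀ ^ s := by
        gcongr
        exact abs_le_jb _ _
    _ ≤ _ := key
    _ = 7 ^ (s + 3 / 2 + ε) / (γ / 2 * ((γ / 3) ^ a) ^ 3) *
          (γ / 2 * jb ξ₁ q₁ * jb ξ₁ q₁ ^ (s - ε) * jb ξ₀ q₀ ^ (-(1 : ℝ) / 2 - ε) *
            ((γ / 3) ^ a * jb ξ₁ q₁ ^ a) * ((γ / 3) ^ a * jb ξ₁ q₁ ^ a) *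
            ((γ / 3) ^ a * jb ξ₁ q₁ ^ a)) := by
        rw [← ha, div_mul_eq_mul_div, eq_div_iff hc.ne']
        ring
    _ ≤ _ := by gcongr
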